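/- For every integer n ≥ 1, there exist a polynomial p ∈ ℚ[x] and a periodic function c : ℕ → ℚ whose minimum period is n such that F_n(t) = p(t) + c(t) for all t ∈ ℕ; that is, all coefficient functions of the quasipolynomial F_n are constant except the degree-0 coefficient, which has minimum period n. -/

import Mathlib

open Finset

/-- `Fqp n k = ∑ C(j, n)` over `0 ≤ j ≤ k` with `j ≡ k (mod n)`. -/
def Fqp (n k : ℕ) : ℕ :=
  ∑ j ∈ (Finset.range (k + 1)).filter (fun j => j % n = k % n), j.choose n

open Polynomial in
/-- Every polynomial over `ℚ` has an antidifference with respect to any nonzero step. -/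
lemma exists_eval_add_eq_add_eval {a : ℚ} (ha : a ≠ 0) (g : ℚ[X]) :
    ∃ q : ℚ[X], q.natDegree ≤ g.natDegree + 1 ∧
      ∀ x, q.eval (x + a) = q.eval x + g.eval x := by
  have hdeg (k : ℕ) : (Polynomial.bernoulli k).natDegree ≤ k := by
    rw [natDegree_le_iff_coeff_eq_zero]
    intro i hi
    rw [Polynomial.coeff_bernoulli, if_neg (by omega)]
  refine ⟨∑ k ∈ range (g.natDegree + 1),
    C (g.coeff k * a ^ k / (k + 1)) * (Polynomial.bernoulli (k + 1)).comp (C a⁻¹ * X), ?_, ?_⟩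
  · refine natDegree_sum_le_of_forall_le _ _ fun k hk => ?_
    have hk' := mem_range.1 hk
    calc _ ≤ ((Polynomial.bernoulli (k + 1)).comp (C a⁻¹ * X)).natDegree :=
          natDegree_C_mul_le _ _
      _ ≤ (Polynomial.bernoulli (k + 1)).natDegree * (C a⁻¹ * X).natDegree :=
          natDegree_comp_le
      _ ≤ (k + 1) * 1 := Nat.mul_le_mul (hdeg _) ((natDegree_C_mul_le _ _).trans natDegree_X_le)
      _ ≤ g.natDegree + 1 := by omega
  · intro x
    rw [eval_eq_sum_range (p := g), eval_finsetSum, eval_finsetSum, ← sum_add_distrib]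
    refine sum_congr rfl fun k _ => ?_
    have h := Polynomial.bernoulli_eval_one_add (k + 1) (a⁻¹ * x)
    have e : a⁻¹ * (x + a) = 1 + a⁻¹ * x := by field_simp; ring
    have hk : (k : ℚ) + 1 ≠ 0 := by positivity
    simp only [eval_mul, eval_C, eval_comp, eval_X, e, h]
    push_cast
    rw [mul_pow, inv_pow]
    field_simp

open Polynomial in
lemma natDegree_taylor_sub_self_le {q : ℚ[X]} {n : ℕ} (hq : q.natDegree ≤ n + 1) (a : ℚ) :
    (taylor a q - q).natDegree ≤ n := by
  by_cases hq0 : q = 0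
  · simp [hq0]
  have h := degree_sub_lt_right (degree_taylor q a) hq0 (leadingCoeff_taylor a q)
  by_cases h0 : taylor a q - q = 0
  · simp [h0]
  have := natDegree_lt_natDegree h0 h
  omega

open Polynomial in
lemma eval_eq_eval_zero_of_periodic {q : ℚ[X]} {a : ℚ} (ha : a ≠ 0)
    (h : ∀ x, q.eval (x + a) = q.eval x) (x : ℚ) : q.eval x = q.eval 0 := by
  have hk (k : ℕ) : q.eval (k * a) = q.eval 0 := by
    induction k with
    | zero => simp
    | succ k ih => rw [← ih, ← h (k * a)]; push_cast; ring_nf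
  have hinj : Function.Injective fun k : ℕ => (k : ℚ) * a := fun i j hij => by
    simpa [ha] using hij
  have : q = C (q.eval 0) := eq_of_infinite_eval_eq _ _
    (Set.infinite_of_injective_forall_mem hinj fun k => by simp [hk k])
  rw [this]; simp

lemma Fqp_of_lt {n k : ℕ} (h : k < n) : Fqp n k = 0 := by
  refine sum_eq_zero fun j hj => Nat.choose_eq_zero_of_lt ?_
  have := mem_range.1 (mem_filter.1 hj).1
  omega

lemma Fqp_add_self {n : ℕ} (hn : 1 ≤ n) (k : ℕ) :
    Fqp n (k + n) = Fqp n k + (k + n).choose n := by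
  have hset : (range (k + n + 1)).filter (fun j => j % n = (k + n) % n) =
      insert (k + n) ((range (k + 1)).filter (fun j => j % n = k % n)) := by
    ext j
    simp only [mem_filter, mem_range, mem_insert, Nat.add_mod_right]
    constructor
    · rintro ⟨hj, hm⟩
      by_cases hjk : j ≤ k
      · exact Or.inr ⟨by omega, hm⟩
      · obtain ⟨m, hm'⟩ := (Nat.modEq_iff_dvd' (by omega)).1 (show k ≡ j [MOD n] from hm.symm)
        have h1 : 0 < m := by
          rcases Nat.eq_zero_or_pos m with rfl | h
          · simp at hm'; omega
          · exact h
        have := Nat.mul_le_mul_left n h1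
        left
        simp at this
        omega
    · rintro (rfl | ⟨hj, hm⟩)
      · exact ⟨by omega, by simp⟩
      · exact ⟨by omega, hm⟩
  rw [Fqp, hset, sum_insert (by simp; omega), add_comm, Fqp]

/-- `Fₙ` is the sum of a polynomial and a periodic function whose minimum period is
exactly `n`: all coefficient functions of the quasipolynomial `Fₙ` are constant
except the degree-0 one, which has minimum period `n`. -/
theorem Fn_polynomial_plus_periodic (n : ℕ) (hn : 1 ≤ n) :
    ∃ (p : Polynomial ℚ) (c : ℕ → ℚ),
      IsLeast {s : ℕ | 0 < s ∧ ∀ t, c (t + s) = c t} n ∧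
      ∀ t : ℕ, (Fqp n t : ℚ) = p.eval (t : ℚ) + c t := by
  have hn0 : (n : ℚ) ≠ 0 := by positivity
  set g : Polynomial ℚ := Polynomial.C ((n.factorial : ℚ)⁻¹) * descPochhammer ℚ n with hg
  have hgdeg : g.natDegree ≤ n :=
    (Polynomial.natDegree_C_mul_le _ _).trans (descPochhammer_natDegree ℚ n).le
  have hgeval (t : ℕ) : g.eval (t : ℚ) = t.choose n := by
    rw [hg, Nat.cast_choose_eq_descPochhammer_div, Polynomial.eval_mul, Polynomial.eval_C,
      div_eq_inv_mul]
  obtain ⟨q, hqdeg, hq⟩ := exists_eval_add_eq_add_eval hn0 g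
  set c : ℕ → ℚ := fun t => (Fqp n t : ℚ) - q.eval ((t : ℚ) + n) with hc
  have hper (t : ℕ) : c (t + n) = c t := by
    have h := hq ((t + n : ℕ) : ℚ)
    rw [hgeval] at h
    push_cast at h
    simp only [hc, Fqp_add_self hn]
    push_cast
    rw [h]
    ring
  -- `q` interpolates `-c` at the first `2 * n` natural numbers.
  have hqc (t : ℕ) (ht : t < 2 * n) : q.eval (t : ℚ) = -c t := by
    rcases lt_or_ge t n with h | h
    · have h' := hq t
      rw [hgeval, Nat.choose_eq_zero_of_lt h, Nat.cast_zero, add_zero] at h'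
      simp [hc, Fqp_of_lt h, h']
    · obtain ⟨y, rfl⟩ := Nat.exists_eq_add_of_le' h
      rw [hper]
      simp [hc, Fqp_of_lt (show y < n by omega)]
  refine ⟨Polynomial.taylor (n : ℚ) q, c, ⟨⟨hn, hper⟩, ?_⟩, fun t => ?_⟩
  · rintro s ⟨hs, hcs⟩
    by_contra! hsn
    have hzero : Polynomial.taylor (s : ℚ) q - q = 0 := by
      refine Polynomial.eq_zero_of_natDegree_lt_card_of_eval_eq_zero _
        (f := fun i : Fin (n + 1) => ((i : ℕ) : ℚ))
        (fun i j hij => Fin.ext (by simpa using hij)) (fun i => ?_) ?_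
      · have h := hqc (i + s) (by omega)
        push_cast at h
        rw [Polynomial.eval_sub, Polynomial.taylor_eval, h, hqc i (by omega), hcs, sub_self]
      · have := natDegree_taylor_sub_self_le (n := n) (by omega) (a := s) (q := q)
        simpa using Nat.lt_succ_of_le this
    have hconst := eval_eq_eval_zero_of_periodic (q := q) (a := s) (by positivity) fun x => by
      rw [← Polynomial.taylor_eval, sub_eq_zero.1 hzero]
    have h := hq n
    rw [hconst, hconst (n : ℚ), hgeval, Nat.choose_self] at h
    norm_num at h
  · rw [Polynomial.taylor_eval]
    simp [hc]
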